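/- arXiv:2309.12703 — 6 statements merged into one kernel-verified Lean document; each statement's English description precedes it below -/
import Mathlib

section
/- The number of distinct pairs (S₋(λ), S₊(λ)), as λ ranges over all admissible linear functionals on ℝ^l, equals l(l+2). (This is the number of equivalence classes of irreducible unitary representations of SO₀(2,2l−1) with non-zero (g,K)-cohomology.) -/
noncomputable section

/-- The `i`-th standard basis vector of `ℝ^l`. -/
def stdVec (l : ℕ) (i : Fin l) : Fin l → ℝ := Pi.single i 1

/-- Compact positive roots of `SO₀(2, 2l-1)` (type `B_l`):
`{eᵢ − eⱼ, eᵢ + eⱼ : 2 ≤ i < j ≤ l} ∪ {eᵢ : 2 ≤ i ≤ l}` (1-indexed in the paper;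
here indices are 0-indexed, so the condition `2 ≤ i` becomes `0 < i`). -/
def DeltaKplusB (l : ℕ) : Set (Fin l → ℝ) :=
  {v | ∃ i j : Fin l, 0 < (i : ℕ) ∧ i < j ∧
      (v = stdVec l i - stdVec l j ∨ v = stdVec l i + stdVec l j)} ∪
  {v | ∃ i : Fin l, 0 < (i : ℕ) ∧ v = stdVec l i}

/-- Noncompact positive roots of `SO₀(2, 2l-1)` (type `B_l`):
`{e₁ − eⱼ : 2 ≤ j ≤ l} ∪ {e₁} ∪ {e₁ + eⱼ : 2 ≤ j ≤ l}` (1-indexed; here 0-indexed). -/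
def DeltaNplusB (l : ℕ) [NeZero l] : Set (Fin l → ℝ) :=
  {v | ∃ j : Fin l, 0 < (j : ℕ) ∧
      (v = stdVec l 0 - stdVec l j ∨ v = stdVec l 0 + stdVec l j)} ∪
  {stdVec l 0}

/-- A linear functional `λ` is admissible if `λ(α) ≥ 0` for all compact positive roots `α`. -/
def AdmissibleB (l : ℕ) (lam : (Fin l → ℝ) →ₗ[ℝ] ℝ) : Prop :=
  ∀ a ∈ DeltaKplusB l, 0 ≤ lam a

/-- `S₊(λ) = {β ∈ Δₙ⁺ : λ(β) > 0}`. -/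
def SplusB (l : ℕ) [NeZero l] (lam : (Fin l → ℝ) →ₗ[ℝ] ℝ) : Set (Fin l → ℝ) :=
  {b | b ∈ DeltaNplusB l ∧ 0 < lam b}

/-- `S₋(λ) = {β ∈ Δₙ⁺ : λ(β) < 0}`. -/
def SminusB (l : ℕ) [NeZero l] (lam : (Fin l → ℝ) →ₗ[ℝ] ℝ) : Set (Fin l → ℝ) :=
  {b | b ∈ DeltaNplusB l ∧ lam b < 0}

/-- The functional on `ℝ^l` taking the value `w i` at the `i`-th basis vector. -/
def functionalOfValues (l : ℕ) (w : Fin l → ℝ) : (Fin l → ℝ) →ₗ[ℝ] ℝ :=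
  Fintype.linearCombination ℝ w

lemma functionalOfValues_stdVec (l : ℕ) (w : Fin l → ℝ) (i : Fin l) :
    functionalOfValues l w (stdVec l i) = w i := by
  simp [functionalOfValues, stdVec, Fintype.linearCombination_apply_single]

lemma admissibleB_iff (l : ℕ) (lam : (Fin l → ℝ) →ₗ[ℝ] ℝ) :
    AdmissibleB l lam ↔
      (∀ i j : Fin l, 0 < (i : ℕ) → i < j → lam (stdVec l j) ≤ lam (stdVec l i)) ∧
        ∀ i : Fin l, 0 < (i : ℕ) → 0 ≤ lam (stdVec l i) := by
  constructor
  · intro h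
    refine ⟨fun i j hi hij => ?_, fun i hi => h _ (Or.inr ⟨i, hi, rfl⟩)⟩
    have := h _ (Or.inl ⟨i, j, hi, hij, Or.inl rfl⟩)
    rw [map_sub] at this
    linarith
  · rintro ⟨h1, h2⟩ a (⟨i, j, hi, hij, rfl | rfl⟩ | ⟨i, hi, rfl⟩)
    · rw [map_sub]
      linarith [h1 i j hi hij]
    · rw [map_add]
      have hj : 0 < (j : ℕ) := hi.trans hij
      linarith [h2 i hi, h2 j hj]
    · exact h2 i hi

lemma signPair_eq_iff (l : ℕ) [NeZero l] (lam mu : (Fin l → ℝ) →ₗ[ℝ] ℝ) :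
    (SminusB l lam, SplusB l lam) = (SminusB l mu, SplusB l mu) ↔
      ∀ b ∈ DeltaNplusB l, (lam b < 0 ↔ mu b < 0) ∧ (0 < lam b ↔ 0 < mu b) := by
  simp only [Prod.mk.injEq, SminusB, SplusB, Set.ext_iff, Set.mem_ofPred_eq]
  grind

lemma forall_mem_DeltaNplusB (l : ℕ) [NeZero l] (P : (Fin l → ℝ) → Prop) :
    (∀ b ∈ DeltaNplusB l, P b) ↔
      P (stdVec l 0) ∧ ∀ j : Fin l, 0 < (j : ℕ) →
        P (stdVec l 0 - stdVec l j) ∧ P (stdVec l 0 + stdVec l j) := by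
  constructor
  · intro h
    exact ⟨h _ (Or.inr rfl), fun j hj =>
      ⟨h _ (Or.inl ⟨j, hj, Or.inl rfl⟩), h _ (Or.inl ⟨j, hj, Or.inr rfl⟩)⟩⟩
  · rintro ⟨h0, h⟩ b (⟨j, hj, rfl | rfl⟩ | rfl)
    exacts [(h j hj).1, (h j hj).2, h0]

/-- `lam` has sign type `(s, a, b)`: its value `x` at `e₁` has the sign of `s`, and among the
remaining coordinates exactly those of index at most `a` (resp. `b`) exceed `|x|`
(resp. are at least `|x|`). -/
def HasSignType (l : ℕ) [NeZero l] (lam : (Fin l → ℝ) →ₗ[ℝ] ℝ) (t : ℤ × ℕ × ℕ) : Prop :=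
  (lam (stdVec l 0) < 0 ↔ t.1 < 0) ∧ (0 < lam (stdVec l 0) ↔ 0 < t.1) ∧
    ∀ j : Fin l, 0 < (j : ℕ) →
      (|lam (stdVec l 0)| < lam (stdVec l j) ↔ (j : ℕ) ≤ t.2.1) ∧
      (|lam (stdVec l 0)| ≤ lam (stdVec l j) ↔ (j : ℕ) ≤ t.2.2)

lemma signs_eq_iff {x y x' y' : ℝ} (hy : 0 ≤ y) (hy' : 0 ≤ y')
    (hneg : x < 0 ↔ x' < 0) (hpos : 0 < x ↔ 0 < x') :
    (((x - y < 0 ↔ x' - y' < 0) ∧ (0 < x - y ↔ 0 < x' - y')) ∧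
      ((x + y < 0 ↔ x' + y' < 0) ∧ (0 < x + y ↔ 0 < x' + y'))) ↔
    ((|x| < y ↔ |x'| < y') ∧ (|x| ≤ y ↔ |x'| ≤ y')) := by
  rcases lt_trichotomy x 0 with h | h | h
  · have h' := hneg.1 h
    rw [abs_of_neg h, abs_of_neg h']
    grind
  · have h' : x' = 0 := by grind
    subst h h'
    simp only [abs_zero]
    grind
  · have h' := hpos.1 h
    rw [abs_of_pos h, abs_of_pos h']
    grind

lemma signPair_eq_iff_abs (l : ℕ) [NeZero l] {lam mu : (Fin l → ℝ) →ₗ[ℝ] ℝ}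
    (hlam : AdmissibleB l lam) (hmu : AdmissibleB l mu) :
    (SminusB l lam, SplusB l lam) = (SminusB l mu, SplusB l mu) ↔
      ((lam (stdVec l 0) < 0 ↔ mu (stdVec l 0) < 0) ∧
        (0 < lam (stdVec l 0) ↔ 0 < mu (stdVec l 0))) ∧
      ∀ j : Fin l, 0 < (j : ℕ) →
        (|lam (stdVec l 0)| < lam (stdVec l j) ↔ |mu (stdVec l 0)| < mu (stdVec l j)) ∧
        (|lam (stdVec l 0)| ≤ lam (stdVec l j) ↔ |mu (stdVec l 0)| ≤ mu (stdVec l j)) := by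
  rw [signPair_eq_iff, forall_mem_DeltaNplusB]
  refine and_congr_right fun h0 => forall₂_congr fun j hj => ?_
  simp only [map_sub, map_add]
  exact signs_eq_iff (((admissibleB_iff l lam).1 hlam).2 j hj)
    (((admissibleB_iff l mu).1 hmu).2 j hj) h0.1 h0.2

/-- The sign types realized by admissible functionals. -/
def signTypes (l : ℕ) : Set (ℤ × ℕ × ℕ) :=
  {t | (t.1 = -1 ∨ t.1 = 0 ∨ t.1 = 1) ∧ t.2.1 ≤ t.2.2 ∧ t.2.2 < l ∧
    (t.1 = 0 → t.2.2 + 1 = l)}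

lemma ncard_signTypes (l : ℕ) : (signTypes l).ncard = l * (l + 2) := by
  have hcard : (Finset.range l ×ˢ Finset.range (l + 2)).card = l * (l + 2) := by simp
  rw [← hcard, ← Set.ncard_coe_finset]
  symm
  refine Set.ncard_congr (fun p _ =>
    if p.1 ≤ p.2 ∧ p.2 < l then (1, p.1, p.2)
    else if p.2 = l then (0, p.1, l - 1)
    else if p.2 = l + 1 then (-1, p.1, p.1)
    else (-1, p.2, p.1)) ?_ ?_ ?_
  · rintro ⟨k, c⟩ h
    simp only [Finset.coe_product, Finset.coe_range, Set.mem_prod, Set.mem_Iio] at h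
    simp only [signTypes, Set.mem_ofPred_eq]
    split_ifs <;> simp <;> omega
  · rintro ⟨k, c⟩ ⟨k', c'⟩ h h'
    simp only [Finset.coe_product, Finset.coe_range, Set.mem_prod, Set.mem_Iio] at h h'
    grind
  · rintro ⟨s, a, b⟩ ⟨hs, hab, hb, h0⟩
    simp only [Finset.coe_product, Finset.coe_range, Set.mem_prod, Set.mem_Iio]
    dsimp only at hs hab hb h0
    rcases hs with rfl | rfl | rfl
    · by_cases h : a = b
      · exact ⟨(a, l + 1), by simp; omega, by simp [h]⟩
      · exact ⟨(b, a), by simp; omega, by grind⟩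
    · exact ⟨(a, l), by simp; omega, by grind⟩
    · exact ⟨(a, b), by simp; omega, by grind⟩

/-- The values on the standard basis of a functional of sign type `(s, a, b)`. -/
def signTypeValues (l : ℕ) (t : ℤ × ℕ × ℕ) (i : Fin l) : ℝ :=
  if (i : ℕ) = 0 then t.1 else
    if (i : ℕ) ≤ t.2.1 then 2 else if (i : ℕ) ≤ t.2.2 then |(t.1 : ℝ)| else 0

lemma exists_hasSignType (l : ℕ) [NeZero l] {t : ℤ × ℕ × ℕ} (ht : t ∈ signTypes l) :
    ∃ lam, AdmissibleB l lam ∧ HasSignType l lam t := by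
  obtain ⟨s, a, b⟩ := t
  obtain ⟨hs, hab, hb, h0⟩ := ht
  dsimp only at hs hab hb h0
  refine ⟨functionalOfValues l (signTypeValues l (s, a, b)), ?_, ?_⟩
  · rw [admissibleB_iff]
    simp only [functionalOfValues_stdVec, signTypeValues]
    constructor
    · intro i j hi hij
      rw [Fin.lt_def] at hij
      rcases hs with rfl | rfl | rfl <;> simp <;> grind
    · intro i hi
      rcases hs with rfl | rfl | rfl <;> simp <;> grind
  · simp only [HasSignType, functionalOfValues_stdVec, signTypeValues]
    refine ⟨by simp, by simp, fun j hj => ?_⟩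
    have := j.isLt
    rcases hs with rfl | rfl | rfl <;> simp <;> grind

lemma exists_forall_iff_le_of_antitone {n : ℕ} (P : ℕ → Prop)
    (hP : ∀ i j, 0 < i → i < j → j < n + 1 → P j → P i) :
    ∃ a ≤ n, ∀ j, 0 < j → j < n + 1 → (P j ↔ j ≤ a) := by
  classical
  refine ⟨Nat.findGreatest P n, Nat.findGreatest_le n, fun j hj hjn =>
    ⟨Nat.le_findGreatest (by omega), fun hle => ?_⟩⟩
  have hg : P (Nat.findGreatest P n) := Nat.findGreatest_of_ne_zero rfl (by omega)
  rcases hle.eq_or_lt with h | h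
  · rwa [h]
  · exact hP _ _ hj h (Nat.lt_succ_of_le (Nat.findGreatest_le n)) hg

lemma exists_forall_fin_iff_le {l : ℕ} [NeZero l] (P : Fin l → Prop)
    (hP : ∀ i j : Fin l, 0 < (i : ℕ) → i < j → P j → P i) :
    ∃ a < l, ∀ j : Fin l, 0 < (j : ℕ) → (P j ↔ (j : ℕ) ≤ a) := by
  obtain ⟨n, rfl⟩ := Nat.exists_eq_succ_of_ne_zero (NeZero.ne l)
  obtain ⟨a, ha, h⟩ := exists_forall_iff_le_of_antitone (n := n)
    (fun k => ∃ hk : k < n + 1, P ⟨k, hk⟩)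
    (fun i j hi hij hj ⟨_, hPj⟩ => ⟨by omega, hP ⟨i, by omega⟩ ⟨j, hj⟩ hi hij hPj⟩)
  refine ⟨a, by omega, fun j hj => ?_⟩
  rw [← h j hj j.isLt]
  exact ⟨fun hp => ⟨j.isLt, hp⟩, fun ⟨_, hp⟩ => hp⟩

lemma exists_signType (l : ℕ) [NeZero l] {lam : (Fin l → ℝ) →ₗ[ℝ] ℝ}
    (hlam : AdmissibleB l lam) : ∃ t ∈ signTypes l, HasSignType l lam t := by
  obtain ⟨hanti, hnn⟩ := (admissibleB_iff l lam).1 hlam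
  obtain ⟨a, ha, hPa⟩ := exists_forall_fin_iff_le
    (fun j => |lam (stdVec l 0)| < lam (stdVec l j))
    (fun i j hi hij h => h.trans_le (hanti i j hi hij))
  obtain ⟨b, hb, hPb⟩ := exists_forall_fin_iff_le
    (fun j => |lam (stdVec l 0)| ≤ lam (stdVec l j))
    (fun i j hi hij h => h.trans (hanti i j hi hij))
  have hab : a ≤ b := by
    rcases Nat.eq_zero_or_pos a with h | h
    · omega
    · exact (hPb ⟨a, ha⟩ h).1 ((hPa ⟨a, ha⟩ h).2 le_rfl).le
  rcases lt_trichotomy (lam (stdVec l 0)) 0 with h | h | h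
  · exact ⟨(-1, a, b), ⟨by simp, hab, hb, by simp⟩, by simpa using h, by simpa using h.le,
      fun j hj => ⟨hPa j hj, hPb j hj⟩⟩
  · refine ⟨(0, a, l - 1), ⟨by simp, by simp; omega, by simp; omega, fun _ => by simp; omega⟩,
      by simp [h], by simp [h], fun j hj => ⟨hPa j hj, ?_⟩⟩
    simp only [h, abs_zero, hnn j hj, true_iff]
    omega
  · exact ⟨(1, a, b), ⟨by simp, hab, hb, by simp⟩, by simpa using h.le, by simpa using h,
      fun j hj => ⟨hPa j hj, hPb j hj⟩⟩

lemma eq_of_forall_fin_le_iff {l a a' : ℕ} (ha : a < l) (ha' : a' < l)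
    (h : ∀ j : Fin l, 0 < (j : ℕ) → ((j : ℕ) ≤ a ↔ (j : ℕ) ≤ a')) : a = a' := by
  have h1 := h ⟨a, ha⟩
  have h2 := h ⟨a', ha'⟩
  dsimp only at h1 h2
  grind

lemma signPair_eq_iff_signType_eq (l : ℕ) [NeZero l] {lam mu : (Fin l → ℝ) →ₗ[ℝ] ℝ}
    (hlam : AdmissibleB l lam) (hmu : AdmissibleB l mu) {t u : ℤ × ℕ × ℕ}
    (ht : t ∈ signTypes l) (hu : u ∈ signTypes l)
    (hlt : HasSignType l lam t) (hmut : HasSignType l mu u) :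
    (SminusB l lam, SplusB l lam) = (SminusB l mu, SplusB l mu) ↔ t = u := by
  rw [signPair_eq_iff_abs l hlam hmu]
  obtain ⟨hl1, hl2, hl3⟩ := hlt
  obtain ⟨hm1, hm2, hm3⟩ := hmut
  constructor
  · rintro ⟨⟨h1, h2⟩, h3⟩
    rw [hl1, hm1] at h1
    rw [hl2, hm2] at h2
    obtain ⟨s, a, b⟩ := t
    obtain ⟨s', a', b'⟩ := u
    obtain ⟨hs, hab, hb, -⟩ := ht
    obtain ⟨hs', hab', hb', -⟩ := hu
    dsimp only at *
    have hss : s = s' := by omega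
    have haa : a = a' := eq_of_forall_fin_le_iff (hab.trans_lt hb) (hab'.trans_lt hb') fun j hj => by
      rw [← (hl3 j hj).1, ← (hm3 j hj).1, (h3 j hj).1]
    have hbb : b = b' := eq_of_forall_fin_le_iff hb hb' fun j hj => by
      rw [← (hl3 j hj).2, ← (hm3 j hj).2, (h3 j hj).2]
    rw [hss, haa, hbb]
  · rintro rfl
    exact ⟨⟨hl1.trans hm1.symm, hl2.trans hm2.symm⟩, fun j hj =>
      ⟨(hl3 j hj).1.trans (hm3 j hj).1.symm, (hl3 j hj).2.trans (hm3 j hj).2.symm⟩⟩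

/-- The number of distinct pairs `(S₋(λ), S₊(λ))`, as `λ` ranges over all
admissible linear functionals on `ℝ^l`, equals `l(l+2)`.  (This is the number of
equivalence classes of irreducible unitary representations of `SO₀(2, 2l−1)` with
non-zero `(g,K)`-cohomology.) -/
theorem numAq_B (l : ℕ) [NeZero l] :
    Set.ncard {p : Set (Fin l → ℝ) × Set (Fin l → ℝ) |
        ∃ lam : (Fin l → ℝ) →ₗ[ℝ] ℝ, AdmissibleB l lam ∧
          p = (SminusB l lam, SplusB l lam)} = l * (l + 2) := by
  rw [← ncard_signTypes l]
  symm
  choose f hf hft using fun t (ht : t ∈ signTypes l) => exists_hasSignType l ht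
  refine Set.ncard_congr (fun t ht => (SminusB l (f t ht), SplusB l (f t ht))) ?_ ?_ ?_
  · exact fun t ht => ⟨f t ht, hf t ht, rfl⟩
  · exact fun t u ht hu h =>
      (signPair_eq_iff_signType_eq l (hf t ht) (hf u hu) ht hu (hft t ht) (hft u hu)).1 h
  · rintro _ ⟨lam, hlam, rfl⟩
    obtain ⟨t, ht, hlt⟩ := exists_signType l hlam
    exact ⟨t, ht, (signPair_eq_iff_signType_eq l (hf t ht) hlam ht ht (hft t ht) hlt).2 rfl⟩
end
end

section
/- The number of distinct pairs (S₋(λ), S₊(λ)), as λ ranges over all admissible linear functionals on ℝ^l, equals l² + 4l − 3. (This is the number of equivalence classes of irreducible unitary representations of SO₀(2,2l−2) with non-zero (g,K)-cohomology.) -/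
noncomputable section

/-- Compact positive roots of `SO₀(2, 2l-2)` (type `D_l`):
`{eᵢ − eⱼ, eᵢ + eⱼ : 2 ≤ i < j ≤ l}` (1-indexed in the paper;
here indices are 0-indexed, so the condition `2 ≤ i` becomes `0 < i`). -/
def DeltaKplusD (l : ℕ) : Set (Fin l → ℝ) :=
  {v | ∃ i j : Fin l, 0 < (i : ℕ) ∧ i < j ∧
      (v = stdVec l i - stdVec l j ∨ v = stdVec l i + stdVec l j)}

/-- Noncompact positive roots of `SO₀(2, 2l-2)` (type `D_l`):
`{e₁ − eⱼ : 2 ≤ j ≤ l} ∪ {e₁ + eⱼ : 2 ≤ j ≤ l}` (1-indexed; here 0-indexed). -/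
def DeltaNplusD (l : ℕ) [NeZero l] : Set (Fin l → ℝ) :=
  {v | ∃ j : Fin l, 0 < (j : ℕ) ∧
      (v = stdVec l 0 - stdVec l j ∨ v = stdVec l 0 + stdVec l j)}

/-- A linear functional `λ` is admissible if `λ(α) ≥ 0` for all compact positive roots `α`. -/
def AdmissibleD (l : ℕ) (lam : (Fin l → ℝ) →ₗ[ℝ] ℝ) : Prop :=
  ∀ a ∈ DeltaKplusD l, 0 ≤ lam a

/-- `S₊(λ) = {β ∈ Δₙ⁺ : λ(β) > 0}`. -/
def SplusD (l : ℕ) [NeZero l] (lam : (Fin l → ℝ) →ₗ[ℝ] ℝ) : Set (Fin l → ℝ) :=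
  {b | b ∈ DeltaNplusD l ∧ 0 < lam b}

/-- `S₋(λ) = {β ∈ Δₙ⁺ : λ(β) < 0}`. -/
def SminusD (l : ℕ) [NeZero l] (lam : (Fin l → ℝ) →ₗ[ℝ] ℝ) : Set (Fin l → ℝ) :=
  {b | b ∈ DeltaNplusD l ∧ lam b < 0}

/-- The coordinates of a functional in the dual of the standard basis. -/
def coordsD (l : ℕ) (lam : (Fin l → ℝ) →ₗ[ℝ] ℝ) (j : Fin l) : ℝ := lam (stdVec l j)

/-- The functional with prescribed coordinates. -/
def ofCoordsD (l : ℕ) (y : Fin l → ℝ) : (Fin l → ℝ) →ₗ[ℝ] ℝ :=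
  (Pi.basisFun ℝ (Fin l)).constr ℝ y

lemma coordsD_ofCoordsD (l : ℕ) (y : Fin l → ℝ) : coordsD l (ofCoordsD l y) = y := by
  ext j
  have h := (Pi.basisFun ℝ (Fin l)).constr_basis ℝ y j
  rwa [Pi.basisFun_apply] at h

lemma admissibleD_iff (l : ℕ) (lam : (Fin l → ℝ) →ₗ[ℝ] ℝ) :
    AdmissibleD l lam ↔ ∀ i j : Fin l, 0 < (i : ℕ) → i < j →
      |coordsD l lam j| ≤ coordsD l lam i := by
  constructor
  · intro h i j hi hij
    have h1 := h _ ⟨i, j, hi, hij, Or.inl rfl⟩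
    have h2 := h _ ⟨i, j, hi, hij, Or.inr rfl⟩
    rw [map_sub] at h1
    rw [map_add] at h2
    rw [abs_le]
    unfold coordsD
    constructor <;> linarith
  · rintro h a ⟨i, j, hi, hij, rfl | rfl⟩
    all_goals
      have := abs_le.1 (h i j hi hij)
      unfold coordsD at this
      simp only [map_sub, map_add]
      linarith

lemma sign_eq_sign_iff {a b : ℝ} :
    SignType.sign a = SignType.sign b ↔ ((a < 0 ↔ b < 0) ∧ (0 < a ↔ 0 < b)) := by
  constructor
  · intro h
    rw [← sign_eq_neg_one_iff, ← sign_eq_neg_one_iff, ← sign_eq_one_iff, ← sign_eq_one_iff, h]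
    simp
  · rintro ⟨h1, h2⟩
    rcases lt_trichotomy a 0 with h | h | h
    · rw [sign_neg h, sign_neg (h1.1 h)]
    · have hb : b = 0 := le_antisymm (not_lt.1 fun hb => by linarith [h2.2 hb])
        (not_lt.1 fun hb => by linarith [h1.2 hb])
      rw [h, hb]
    · rw [sign_pos h, sign_pos (h2.1 h)]

/-- Two functionals have the same pair `(S₋, S₊)` iff they have the same signs on all
noncompact roots. -/
lemma pairD_eq_iff (l : ℕ) [NeZero l] (lam mu : (Fin l → ℝ) →ₗ[ℝ] ℝ) :
    (SminusD l lam, SplusD l lam) = (SminusD l mu, SplusD l mu) ↔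
      ∀ j : Fin l, 0 < (j : ℕ) →
        SignType.sign (coordsD l lam 0 - coordsD l lam j) =
          SignType.sign (coordsD l mu 0 - coordsD l mu j) ∧
        SignType.sign (coordsD l lam 0 + coordsD l lam j) =
          SignType.sign (coordsD l mu 0 + coordsD l mu j) := by
  have key : (SminusD l lam, SplusD l lam) = (SminusD l mu, SplusD l mu) ↔
      ∀ b ∈ DeltaNplusD l, SignType.sign (lam b) = SignType.sign (mu b) := by
    simp only [Prod.mk.injEq, Set.ext_iff, SminusD, SplusD, Set.mem_ofPred_eq, sign_eq_sign_iff,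
      and_congr_right_iff]
    exact ⟨fun h b hb => ⟨h.1 b hb, h.2 b hb⟩,
      fun h => ⟨fun b hb => (h b hb).1, fun b hb => (h b hb).2⟩⟩
  rw [key]
  unfold coordsD
  constructor
  · intro h j hj
    have h1 := h _ ⟨j, hj, Or.inl rfl⟩
    have h2 := h _ ⟨j, hj, Or.inr rfl⟩
    simp only [map_sub, map_add] at h1 h2
    exact ⟨h1, h2⟩
  · rintro h b ⟨j, hj, rfl | rfl⟩
    · simpa only [map_sub] using (h j hj).1
    · simpa only [map_add] using (h j hj).2

/-- The signs of `x ± a` for `a ≥ |c|` are determined by the signs of `x ± c` and by the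
comparison of `a` with `|x|`. -/
lemma sign_determined {x c a x' c' a' : ℝ} (h : |c| ≤ a) (h' : |c'| ≤ a')
    (hs : SignType.sign (x - c) = SignType.sign (x' - c'))
    (ht : SignType.sign (x + c) = SignType.sign (x' + c'))
    (hlt : |x| < a ↔ |x'| < a') (hle : |x| ≤ a ↔ |x'| ≤ a') :
    SignType.sign (x - a) = SignType.sign (x' - a') ∧
      SignType.sign (x + a) = SignType.sign (x' + a') := by
  rw [abs_le] at h h'
  simp only [abs_lt, abs_le] at hlt hle
  simp only [sign_eq_sign_iff] at *
  grind

/-- A decreasing predicate on the indices `1, …, n` is the predicate `j ≤ p` for some `p`. -/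
lemma exists_threshold (n : ℕ) (Q : ℕ → Prop)
    (hQ : ∀ i j, 0 < i → i < j → j ≤ n → Q j → Q i) :
    ∃ p ≤ n, ∀ j, 0 < j → j ≤ n → (j ≤ p ↔ Q j) := by
  induction n with
  | zero => exact ⟨0, le_rfl, fun j h1 h2 => by omega⟩
  | succ n ih =>
    obtain ⟨p, hp, h⟩ := ih fun i j hi hij hj => hQ i j hi hij (by omega)
    by_cases hn : Q (n + 1)
    · refine ⟨n + 1, le_rfl, fun j h1 h2 => ⟨fun _ => ?_, fun _ => h2⟩⟩
      rcases h2.lt_or_eq with h3 | rfl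
      · exact hQ j (n + 1) h1 h3 le_rfl hn
      · exact hn
    · refine ⟨p, by omega, fun j h1 h2 => ?_⟩
      rcases h2.lt_or_eq with h3 | rfl
      · exact h j h1 (by omega)
      · exact ⟨fun _ => by omega, fun h4 => absurd h4 hn⟩

/-- The possible values of `(r, p)`, where `r` and `p` are the numbers of indices `1 < j < l` with
`|λ(e₁)| ≤ λ(eⱼ)` and `|λ(e₁)| < λ(eⱼ)`, when `λ(e₁ ∓ e_l)` have signs `d`, and `n = l - 2`. -/
def cellD (n : ℕ) (d : SignType × SignType) : Finset (Σ _ : ℕ, ℕ) :=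
  if d.1 = 0 ∨ d.2 = 0 then Finset.sigma {n} fun _ => Finset.range (n + 1)
  else if d.1 = d.2 then (Finset.range (n + 1)).sigma fun r => Finset.range (r + 1)
  else {⟨n, n⟩}

/-- The combinatorial invariants of admissible functionals, for `n = l - 2`. -/
def codesD (n : ℕ) : Finset (Σ _ : SignType × SignType, Σ _ : ℕ, ℕ) :=
  Finset.univ.sigma (cellD n)

lemma card_codesD (n : ℕ) : (codesD n).card = n * n + 8 * n + 9 := by
  have hu : (Finset.univ : Finset SignType) = {0, -1, 1} := by decide
  have hg : (∑ i ∈ Finset.range (n + 1), (i + 1)) * 2 = (n + 1) * (n + 2) := by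
    induction n with
    | zero => simp
    | succ n ih => rw [Finset.sum_range_succ, add_mul, ih]; ring
  simp [codesD, cellD, Finset.card_sigma, Fintype.sum_prod_type, hu]
  ring_nf at hg ⊢
  lia

lemma mem_codesD {n : ℕ} {s t : SignType} {r p : ℕ} :
    (⟨(s, t), r, p⟩ : Σ _ : SignType × SignType, Σ _ : ℕ, ℕ) ∈ codesD n ↔
      p ≤ r ∧ r ≤ n ∧ ((s = 0 ∨ t = 0) → r = n) ∧ (s ≠ 0 → t ≠ 0 → s ≠ t → p = n) := by
  simp only [codesD, cellD, Finset.mem_sigma, Finset.mem_univ, true_and]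
  split_ifs with h1 h2
  · simp only [Finset.mem_sigma, Finset.mem_singleton, Finset.mem_range]
    grind
  · simp only [Finset.mem_sigma, Finset.mem_range]
    grind
  · simp only [Finset.mem_singleton, Sigma.mk.injEq, heq_eq_eq]
    grind

/-- Coordinates of a functional with given invariants. -/
def modelD (l : ℕ) (c : Σ _ : SignType × SignType, Σ _ : ℕ, ℕ) (j : Fin l) : ℝ :=
  if (j : ℕ) = 0 then (c.1.1 : ℝ) + c.1.2
  else if (j : ℕ) = l - 1 then (c.1.2 : ℝ) - c.1.1
  else if (j : ℕ) ≤ c.2.2 then 3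
  else if (j : ℕ) ≤ c.2.1 then |(c.1.1 : ℝ) + c.1.2|
  else |(c.1.2 : ℝ) - c.1.1|

/-- `y` has the invariants `c`. -/
def HasCodeD (l : ℕ) [NeZero l] (y : Fin l → ℝ) (c : Σ _ : SignType × SignType, Σ _ : ℕ, ℕ) :
    Prop :=
  ∀ j : Fin l, 0 < (j : ℕ) →
    ((j : ℕ) = l - 1 → SignType.sign (y 0 - y j) = c.1.1 ∧ SignType.sign (y 0 + y j) = c.1.2) ∧
    ((j : ℕ) < l - 1 → ((j : ℕ) ≤ c.2.1 ↔ |y 0| ≤ y j) ∧ ((j : ℕ) ≤ c.2.2 ↔ |y 0| < y j))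

lemma modelD_abs_le {l : ℕ} {c : Σ _ : SignType × SignType, Σ _ : ℕ, ℕ}
    (hc : c ∈ codesD (l - 2)) (i j : Fin l) (hi : 0 < (i : ℕ)) (hij : i < j) :
    |modelD l c j| ≤ modelD l c i := by
  obtain ⟨⟨s, t⟩, r, p⟩ := c
  rw [mem_codesD] at hc
  have hij' : (i : ℕ) < j := hij
  have hj := j.isLt
  obtain ⟨h1, h2, h3, h4⟩ := hc
  unfold modelD
  cases s <;> cases t <;> simp at h3 h4 ⊢ <;> split_ifs <;> first | omega | norm_num

lemma modelD_hasCode {l : ℕ} [NeZero l] {c : Σ _ : SignType × SignType, Σ _ : ℕ, ℕ}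
    (hc : c ∈ codesD (l - 2)) : HasCodeD l (modelD l c) c := by
  obtain ⟨⟨s, t⟩, r, p⟩ := c
  rw [mem_codesD] at hc
  obtain ⟨h1, h2, h3, h4⟩ := hc
  intro j hj0
  have hj := j.isLt
  have hz : modelD l ⟨(s, t), r, p⟩ 0 = (s : ℝ) + t := by simp [modelD]
  rw [hz]
  unfold modelD
  refine ⟨fun hl => ?_, fun hl => ?_⟩
  · rw [if_neg (by omega), if_pos hl]
    have e1 : (s : ℝ) + t - (t - s) = 2 * s := by ring
    have e2 : (s : ℝ) + t + (t - s) = 2 * t := by ring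
    simp only [e1, e2]
    cases s <;> cases t <;> simp
  · rw [if_neg (by omega), if_neg (by omega)]
    cases s <;> cases t <;> simp at h3 h4 ⊢ <;> split_ifs <;>
      first
        | omega
        | (norm_num; try omega)

/-- Admissible functionals with the same invariants have the same pair `(S₋, S₊)`. -/
lemma pairD_eq_of_hasCode {l : ℕ} [NeZero l] (hl : 2 ≤ l) {lam mu : (Fin l → ℝ) →ₗ[ℝ] ℝ}
    (hlam : AdmissibleD l lam) (hmu : AdmissibleD l mu)
    {c : Σ _ : SignType × SignType, Σ _ : ℕ, ℕ}
    (h : HasCodeD l (coordsD l lam) c) (h' : HasCodeD l (coordsD l mu) c) :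
    (SminusD l lam, SplusD l lam) = (SminusD l mu, SplusD l mu) := by
  rw [admissibleD_iff] at hlam hmu
  rw [pairD_eq_iff]
  intro j hj
  let e : Fin l := ⟨l - 1, by omega⟩
  have he := (h e (by simp only [e]; omega)).1 rfl
  have he' := (h' e (by simp only [e]; omega)).1 rfl
  have hjl := j.isLt
  by_cases hje : (j : ℕ) = l - 1
  · have hj' : j = e := Fin.ext hje
    rw [hj']
    exact ⟨he.1.trans he'.1.symm, he.2.trans he'.2.symm⟩
  · have hlt : (j : ℕ) < l - 1 := by omega
    have hm := (h j hj).2 hlt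
    have hn := (h' j hj).2 hlt
    exact sign_determined (hlam j e hj hlt) (hmu j e hj hlt) (he.1.trans he'.1.symm)
      (he.2.trans he'.2.symm) (hm.2.symm.trans hn.2) (hm.1.symm.trans hn.1)

/-- The pair `(S₋, S₊)` determines the invariants. -/
lemma code_eq_of_pairD_eq {l : ℕ} [NeZero l] (hl : 2 ≤ l) {lam mu : (Fin l → ℝ) →ₗ[ℝ] ℝ}
    {c c' : Σ _ : SignType × SignType, Σ _ : ℕ, ℕ}
    (hc : c ∈ codesD (l - 2)) (hc' : c' ∈ codesD (l - 2))
    (h : HasCodeD l (coordsD l lam) c) (h' : HasCodeD l (coordsD l mu) c')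
    (heq : (SminusD l lam, SplusD l lam) = (SminusD l mu, SplusD l mu)) : c = c' := by
  rw [pairD_eq_iff] at heq
  obtain ⟨⟨s, t⟩, r, p⟩ := c
  obtain ⟨⟨s', t'⟩, r', p'⟩ := c'
  rw [mem_codesD] at hc hc'
  let e : Fin l := ⟨l - 1, by omega⟩
  have he0 : 0 < (e : ℕ) := by simp only [e]; omega
  have he := (h e he0).1 rfl
  have he' := (h' e he0).1 rfl
  have hee := heq e he0
  have hs : s = s' := he.1.symm.trans (hee.1.trans he'.1)
  have ht : t = t' := he.2.symm.trans (hee.2.trans he'.2)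
  have hmid : ∀ j : ℕ, 0 < j → j ≤ l - 2 → (j ≤ r ↔ j ≤ r') ∧ (j ≤ p ↔ j ≤ p') := by
    intro j hj hjl
    let k : Fin l := ⟨j, by omega⟩
    have hk := (h k hj).2 (by simp only [k]; omega)
    have hk' := (h' k hj).2 (by simp only [k]; omega)
    have hq := heq k hj
    simp only [sign_eq_sign_iff] at hq
    refine ⟨hk.1.trans (Iff.trans ?_ hk'.1.symm), hk.2.trans (Iff.trans ?_ hk'.2.symm)⟩
    · simp only [abs_le]
      grind
    · simp only [abs_lt]
      grind
  have hr : r = r' := by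
    have h1 := hmid r
    have h2 := hmid r'
    omega
  have hp : p = p' := by
    have h1 := hmid p
    have h2 := hmid p'
    omega
  rw [hs, ht, hr, hp]

lemma exists_code {l : ℕ} [NeZero l] (hl : 2 ≤ l) {lam : (Fin l → ℝ) →ₗ[ℝ] ℝ}
    (hlam : AdmissibleD l lam) : ∃ c ∈ codesD (l - 2), HasCodeD l (coordsD l lam) c := by
  rw [admissibleD_iff] at hlam
  set y := coordsD l lam
  let e : Fin l := ⟨l - 1, by omega⟩
  let z : ℕ → ℝ := fun j => if h : j < l then y ⟨j, h⟩ else 0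
  have hz : ∀ j : Fin l, z j = y j := fun j => by simp [z]
  have hmono : ∀ i j, 0 < i → i < j → j ≤ l - 2 → z j ≤ z i := by
    intro i j hi hij hj
    have h := hlam ⟨i, by omega⟩ ⟨j, by omega⟩ hi hij
    rw [← hz, ← hz] at h
    exact (le_abs_self _).trans h
  obtain ⟨r, hr, hr'⟩ := exists_threshold (l - 2) (fun j => |y 0| ≤ z j)
    fun i j hi hij hj h => h.trans (hmono i j hi hij hj)
  obtain ⟨p, hp, hp'⟩ := exists_threshold (l - 2) (fun j => |y 0| < z j)
    fun i j hi hij hj h => h.trans_le (hmono i j hi hij hj)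
  have hlast : ∀ j, 0 < j → j ≤ l - 2 → |y e| ≤ z j := by
    intro j hj hjl
    have h := hlam ⟨j, by omega⟩ e hj (by rw [Fin.lt_def]; simp only [e]; omega)
    rwa [← hz ⟨j, _⟩] at h
  refine ⟨⟨(SignType.sign (y 0 - y e), SignType.sign (y 0 + y e)), r, p⟩, ?_, ?_⟩
  · rw [mem_codesD]
    refine ⟨?_, hr, fun h => ?_, fun h1 h2 h3 => ?_⟩
    · rcases Nat.eq_zero_or_pos p with h | h
      · omega
      · exact (hr' p h hp).2 ((hp' p h hp).1 le_rfl).le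
    · have hx : |y 0| ≤ |y e| := by
        simp only [sign_eq_zero_iff] at h
        rcases h with h | h
        · rw [sub_eq_zero.1 h]
        · rw [eq_neg_of_add_eq_zero_left h, abs_neg]
      rcases Nat.eq_zero_or_pos (l - 2) with h0 | h0
      · omega
      · exact le_antisymm hr ((hr' _ h0 le_rfl).2 (hx.trans (hlast _ h0 le_rfl)))
    · have hx : |y 0| < |y e| := by
        rw [Ne, sign_eq_zero_iff] at h1 h2
        rw [lt_abs]
        rcases lt_or_gt_of_ne h1 with h | h <;> rcases lt_or_gt_of_ne h2 with h' | h'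
        · exact absurd ((sign_neg h).trans (sign_neg h').symm) h3
        · exact Or.inl (abs_lt.2 ⟨by linarith, by linarith⟩)
        · exact Or.inr (abs_lt.2 ⟨by linarith, by linarith⟩)
        · exact absurd ((sign_pos h).trans (sign_pos h').symm) h3
      rcases Nat.eq_zero_or_pos (l - 2) with h0 | h0
      · omega
      · exact le_antisymm hp ((hp' _ h0 le_rfl).2 (hx.trans_le (hlast _ h0 le_rfl)))
  · intro j hj
    refine ⟨fun h => ?_, fun h => ?_⟩
    · have hj' : j = e := Fin.ext h
      rw [hj']
      exact ⟨rfl, rfl⟩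
    · rw [← hz j]
      exact ⟨hr' j hj (by omega), hp' j hj (by omega)⟩

/-- The number of distinct pairs `(S₋(λ), S₊(λ))`, as `λ` ranges over all
admissible linear functionals on `ℝ^l`, equals `l² + 4l − 3`.  (This is the number of
equivalence classes of irreducible unitary representations of `SO₀(2, 2l−2)` with
non-zero `(g,K)`-cohomology.) -/
theorem numAq_D (l : ℕ) [NeZero l] (hl : 2 ≤ l) :
    Set.ncard {p : Set (Fin l → ℝ) × Set (Fin l → ℝ) |
        ∃ lam : (Fin l → ℝ) →ₗ[ℝ] ℝ, AdmissibleD l lam ∧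
          p = (SminusD l lam, SplusD l lam)} = l * l + 4 * l - 3 := by
  have hadm : ∀ c ∈ codesD (l - 2), AdmissibleD l (ofCoordsD l (modelD l c)) := by
    intro c hc
    rw [admissibleD_iff, coordsD_ofCoordsD]
    exact modelD_abs_le hc
  have hcode : ∀ c ∈ codesD (l - 2),
      HasCodeD l (coordsD l (ofCoordsD l (modelD l c))) c := by
    intro c hc
    rw [coordsD_ofCoordsD]
    exact modelD_hasCode hc
  let P : ((Fin l → ℝ) →ₗ[ℝ] ℝ) → Set (Fin l → ℝ) × Set (Fin l → ℝ) :=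
    fun lam => (SminusD l lam, SplusD l lam)
  have himage : {p : Set (Fin l → ℝ) × Set (Fin l → ℝ) |
      ∃ lam : (Fin l → ℝ) →ₗ[ℝ] ℝ, AdmissibleD l lam ∧ p = (SminusD l lam, SplusD l lam)} =
      (fun c => P (ofCoordsD l (modelD l c))) '' (codesD (l - 2) : Set _) := by
    ext q
    constructor
    · rintro ⟨lam, hlam, rfl⟩
      obtain ⟨c, hc, h⟩ := exists_code hl hlam
      exact ⟨c, hc, pairD_eq_of_hasCode hl (hadm c hc) hlam (hcode c hc) h⟩
    · rintro ⟨c, hc, rfl⟩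
      exact ⟨_, hadm c hc, rfl⟩
  rw [himage, Set.InjOn.ncard_image, Set.ncard_coe_finset, card_codesD]
  · obtain ⟨n, rfl⟩ := Nat.exists_eq_add_of_le' hl
    have h : (n + 2) * (n + 2) + 4 * (n + 2) = n * n + 8 * n + 9 + 3 := by ring
    rw [h, Nat.add_sub_cancel, Nat.add_sub_cancel]
  · intro c hc c' hc' h
    exact code_eq_of_pairD_eq hl hc hc' (hcode c hc) (hcode c' hc') h
end
end

section
/- If λ is an admissible linear functional on ℝ^l with S₋(λ) ∪ S₊(λ) = Δ_n⁺, then there exists a linear functional λ′ on ℝ^l such that λ′(α) > 0 for every α ∈ Δ_k⁺, λ′(β) ≠ 0 for every β ∈ Δ_n⁺, S₊(λ′) = S₊(λ), and S₋(λ′) = S₋(λ). (This shows the corresponding A_q is a discrete series representation of SO₀(2,2l−1), realized by a θ-stable Borel subalgebra.) -/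
noncomputable section

open Filter Topology in
/-- A small positive perturbation of a linear functional keeps its signs on a finite set
where it does not vanish. -/
theorem exists_pos_sign_add_smul_eq {V : Type*} [AddCommGroup V] [Module ℝ V] {S : Set V}
    (hS : S.Finite) (f g : V →ₗ[ℝ] ℝ) (hf : ∀ b ∈ S, f b ≠ 0) :
    ∃ ε : ℝ, 0 < ε ∧ ∀ b ∈ S, SignType.sign ((f + ε • g) b) = SignType.sign (f b) := by
  have key : ∀ b ∈ S, ∀ᶠ ε in 𝓝[>] (0 : ℝ),
      SignType.sign ((f + ε • g) b) = SignType.sign (f b) := by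
    intro b hb
    have hc : Tendsto (fun ε : ℝ => f b + ε * g b) (𝓝[>] 0) (𝓝 (f b)) := by
      have : Continuous fun ε : ℝ => f b + ε * g b := by fun_prop
      simpa using (this.tendsto 0).mono_left nhdsWithin_le_nhds
    rcases (hf b hb).lt_or_gt with h | h
    · filter_upwards [hc.eventually_lt_const h] with ε hε
      rw [sign_neg h]
      exact sign_neg (by simpa using hε)
    · filter_upwards [hc.eventually_const_lt h] with ε hε
      rw [sign_pos h]
      exact sign_pos (by simpa using hε)
  obtain ⟨ε, h, hε⟩ := (((eventually_all_finite hS).2 key).and self_mem_nhdsWithin).exists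
  exact ⟨ε, hε, h⟩

theorem finite_DeltaNplusB (l : ℕ) [NeZero l] : (DeltaNplusB l).Finite := by
  refine Set.Finite.subset
    (((Set.finite_range fun j => stdVec l 0 - stdVec l j).union
      (Set.finite_range fun j => stdVec l 0 + stdVec l j)).union
      (Set.finite_singleton (stdVec l 0))) ?_
  rintro v (⟨j, -, rfl | rfl⟩ | hv)
  · exact Or.inl (Or.inl ⟨j, rfl⟩)
  · exact Or.inl (Or.inr ⟨j, rfl⟩)
  · exact Or.inr hv

/-- There is a linear functional which is positive on all compact positive roots. -/
theorem exists_pos_on_DeltaKplusB (l : ℕ) :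
    ∃ rho : (Fin l → ℝ) →ₗ[ℝ] ℝ, ∀ a ∈ DeltaKplusB l, 0 < rho a := by
  let rho := Fintype.linearCombination ℝ fun i : Fin l => (l : ℝ) - (i : ℕ)
  have hrho (i : Fin l) : rho (stdVec l i) = (l : ℝ) - (i : ℕ) := by
    simp [rho, stdVec, Fintype.linearCombination_apply_single]
  have hlt (i : Fin l) : ((i : ℕ) : ℝ) < l := by exact_mod_cast i.isLt
  refine ⟨rho, ?_⟩
  rintro a (⟨i, j, -, hij, rfl | rfl⟩ | ⟨i, -, rfl⟩)
  · have : ((i : ℕ) : ℝ) < (j : ℕ) := by exact_mod_cast hij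
    rw [map_sub, hrho, hrho]
    linarith
  · rw [map_add, hrho, hrho]
    linarith [hlt i, hlt j]
  · rw [hrho]
    linarith [hlt i]

/-- If `λ` is admissible with `S₋(λ) ∪ S₊(λ) = Δₙ⁺`, then there is a linear
functional `λ'` positive on all compact positive roots, nonvanishing on all noncompact
positive roots, with `S₊(λ') = S₊(λ)` and `S₋(λ') = S₋(λ)`.  (Hence the corresponding
`A_q` is a discrete series representation of `SO₀(2, 2l−1)`.) -/
theorem exists_regular_B (l : ℕ) [NeZero l] (lam : (Fin l → ℝ) →ₗ[ℝ] ℝ)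
    (hadm : AdmissibleB l lam)
    (hfull : SminusB l lam ∪ SplusB l lam = DeltaNplusB l) :
    ∃ lam' : (Fin l → ℝ) →ₗ[ℝ] ℝ,
      (∀ a ∈ DeltaKplusB l, 0 < lam' a) ∧
      (∀ b ∈ DeltaNplusB l, lam' b ≠ 0) ∧
      SplusB l lam' = SplusB l lam ∧
      SminusB l lam' = SminusB l lam := by
  have hne : ∀ b ∈ DeltaNplusB l, lam b ≠ 0 := by
    intro b hb
    rw [← hfull] at hb
    rcases hb with hb | hb
    · exact hb.2.ne
    · exact hb.2.ne'
  obtain ⟨rho, hrho⟩ := exists_pos_on_DeltaKplusB l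
  obtain ⟨ε, hε, hsign⟩ := exists_pos_sign_add_smul_eq (finite_DeltaNplusB l) lam rho hne
  refine ⟨lam + ε • rho, fun a ha => ?_, fun b hb => ?_, ?_, ?_⟩
  · exact add_pos_of_nonneg_of_pos (hadm a ha) (mul_pos hε (hrho a ha))
  · rw [← sign_ne_zero, hsign b hb]
    exact sign_ne_zero.2 (hne b hb)
  · ext b
    refine and_congr_right fun hb => ?_
    rw [← sign_eq_one_iff, hsign b hb, sign_eq_one_iff]
  · ext b
    refine and_congr_right fun hb => ?_
    rw [← sign_eq_neg_one_iff, hsign b hb, sign_eq_neg_one_iff]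
end
end

section
/- Let l ≥ 2, let 1 ≤ i ≤ l−1, and let λ be an admissible linear functional on ℝ^l (type B_l data) with S₋(λ) = {e_1 − e_j : 2 ≤ j ≤ i+1}. Then λ(e_1 + e_{i+1}) > 0, i.e. e_1 + e_{i+1} ∈ S₊(λ). (In particular S₊(λ) is nonempty in this case.) -/
noncomputable section

/-- let `l ≥ 2`, `1 ≤ i ≤ l−1`, and `λ` admissible (type `B_l` data) with
`S₋(λ) = {e₁ − eⱼ : 2 ≤ j ≤ i+1}` (1-indexed; 0-indexed: `1 ≤ j ≤ i`).  Then
`λ(e₁ + e_{i+1}) > 0`, i.e. `e₁ + e_{i+1} ∈ S₊(λ)` (0-indexed: `e₀ + eᵢ`). -/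
theorem mem_Splus_of_Sminus_chain_B (l : ℕ) [NeZero l] (hl : 2 ≤ l)
    (i : ℕ) (hi1 : 1 ≤ i) (hi2 : i ≤ l - 1)
    (lam : (Fin l → ℝ) →ₗ[ℝ] ℝ) (hadm : AdmissibleB l lam)
    (hminus : SminusB l lam =
      {v | ∃ j : Fin l, 1 ≤ (j : ℕ) ∧ (j : ℕ) ≤ i ∧ v = stdVec l 0 - stdVec l j}) :
    stdVec l 0 + stdVec l ⟨i, by omega⟩ ∈ SplusB l lam := by
  set k : Fin l := ⟨i, by omega⟩
  have hneg : lam (stdVec l 0 - stdVec l k) < 0 := by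
    have h : stdVec l 0 - stdVec l k ∈ SminusB l lam := by
      rw [hminus]
      exact ⟨k, hi1, le_rfl, rfl⟩
    exact h.2
  have hnonneg : 0 ≤ lam (stdVec l 0) := by
    by_contra! hlt
    have h : stdVec l 0 ∈ SminusB l lam := ⟨Or.inr rfl, hlt⟩
    rw [hminus] at h
    obtain ⟨j, -, -, hj⟩ := h
    have h := congrFun hj j
    simp only [stdVec, Pi.sub_apply, Pi.single_eq_same] at h
    linarith
  rw [map_sub] at hneg
  refine ⟨Or.inl ⟨k, hi1, Or.inr rfl⟩, ?_⟩
  rw [map_add]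
  linarith
end
end

section
/- The number of distinct sets S₊(λ), as λ ranges over the admissible linear functionals on ℝ^l (type B_l data) with S₋(λ) = ∅, equals l + 1. -/
noncomputable section

/-- The functional `x ↦ ∑_{j < k} xⱼ`. -/
def initialSum (l k : ℕ) : (Fin l → ℝ) →ₗ[ℝ] ℝ :=
  Fintype.linearCombination ℝ fun j : Fin l => if (j : ℕ) < k then (1 : ℝ) else 0

lemma initialSum_stdVec (l k : ℕ) (i : Fin l) :
    initialSum l k (stdVec l i) = if (i : ℕ) < k then 1 else 0 := by
  simp [initialSum, stdVec, Fintype.linearCombination_apply_single]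

lemma stdVec_zero_mem_DeltaNplusB (l : ℕ) [NeZero l] : stdVec l 0 ∈ DeltaNplusB l :=
  Or.inr rfl

lemma sub_mem_DeltaNplusB {l : ℕ} [NeZero l] {j : Fin l} (hj : 0 < (j : ℕ)) :
    stdVec l 0 - stdVec l j ∈ DeltaNplusB l :=
  Or.inl ⟨j, hj, Or.inl rfl⟩

lemma admissibleB_initialSum (l k : ℕ) : AdmissibleB l (initialSum l k) := by
  rintro a (⟨i, j, hi, hij, rfl | rfl⟩ | ⟨i, hi, rfl⟩) <;>
    simp only [map_sub, map_add, initialSum_stdVec] <;> grind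

lemma SminusB_initialSum (l k : ℕ) [NeZero l] : SminusB l (initialSum l k) = ∅ := by
  refine Set.eq_empty_of_forall_notMem ?_
  rintro b ⟨⟨j, hj, rfl | rfl⟩ | rfl, hb⟩ <;>
    simp only [map_sub, map_add, initialSum_stdVec, Fin.val_zero] at hb <;> grind

lemma SplusB_initialSum_ne {l k m : ℕ} [NeZero l] (hkm : k < m) (hm : m ≤ l) :
    SplusB l (initialSum l k) ≠ SplusB l (initialSum l m) := by
  intro h
  rcases Nat.eq_zero_or_pos k with rfl | hk
  · have hmem : stdVec l 0 ∈ SplusB l (initialSum l m) :=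
      ⟨stdVec_zero_mem_DeltaNplusB l, by simp [initialSum_stdVec, hkm]⟩
    rw [← h] at hmem
    simpa [initialSum_stdVec] using hmem.2
  · let j : Fin l := ⟨k, hkm.trans_le hm⟩
    have hmem : stdVec l 0 - stdVec l j ∈ SplusB l (initialSum l k) :=
      ⟨sub_mem_DeltaNplusB hk, by simp [initialSum_stdVec, hk, j]⟩
    rw [h] at hmem
    simpa [initialSum_stdVec, hkm, hk.trans hkm, j] using hmem.2

lemma exists_forall_val_lt_iff {l : ℕ} (P : Fin l → Prop)
    (hP : ∀ i j, i ≤ j → P j → P i) : ∃ k ≤ l, ∀ j : Fin l, (j : ℕ) < k ↔ P j := by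
  classical
  have hex : ∃ n, ∀ h : n < l, ¬ P ⟨n, h⟩ := ⟨l, fun h => absurd h (lt_irrefl l)⟩
  refine ⟨Nat.find hex, Nat.find_min' hex fun h => absurd h (lt_irrefl l),
    fun j => ⟨fun hj => ?_, fun hj => ?_⟩⟩
  · simpa using Nat.find_min hex hj
  · by_contra! hle
    exact Nat.find_spec hex (hle.trans_lt j.2) (hP _ j hle hj)

lemma exists_SplusB_eq_initialSum {l : ℕ} [NeZero l] {lam : (Fin l → ℝ) →ₗ[ℝ] ℝ}
    (hadm : AdmissibleB l lam) (hneg : SminusB l lam = ∅) :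
    ∃ k ≤ l, SplusB l lam = SplusB l (initialSum l k) := by
  have hN : ∀ b ∈ DeltaNplusB l, 0 ≤ lam b := fun b hb => by
    by_contra! hlt
    exact Set.eq_empty_iff_forall_notMem.mp hneg b ⟨hb, hlt⟩
  have hzero : 0 ≤ lam (stdVec l 0) := hN _ (stdVec_zero_mem_DeltaNplusB l)
  have hle : ∀ j : Fin l, 0 < (j : ℕ) → lam (stdVec l j) ≤ lam (stdVec l 0) := fun j hj => by
    simpa using hN _ (sub_mem_DeltaNplusB hj)
  have hnonneg : ∀ j : Fin l, 0 < (j : ℕ) → 0 ≤ lam (stdVec l j) := fun j hj =>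
    hadm _ (Or.inr ⟨j, hj, rfl⟩)
  have hanti : ∀ i j : Fin l, 0 < (i : ℕ) → i < j → lam (stdVec l j) ≤ lam (stdVec l i) :=
    fun i j hi hij => by
      simpa using hadm (stdVec l i - stdVec l j) (Or.inl ⟨i, j, hi, hij, Or.inl rfl⟩)
  obtain ⟨k, hkl, hk⟩ := exists_forall_val_lt_iff
    (fun j => 0 < lam (stdVec l 0) ∧ lam (stdVec l j) = lam (stdVec l 0)) (by
      rintro i j hij ⟨hpos, hj⟩
      refine ⟨hpos, ?_⟩
      rcases hij.eq_or_lt with rfl | hij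
      · exact hj
      rcases Nat.eq_zero_or_pos (i : ℕ) with hi | hi
      · rw [Fin.val_eq_zero_iff.mp hi]
      · exact le_antisymm (hle i hi) (hj ▸ hanti i j hi hij))
  have hk0 : 0 < k ↔ 0 < lam (stdVec l 0) := by simpa using hk 0
  refine ⟨k, hkl, Set.ext fun b => and_congr_right ?_⟩
  rintro (⟨j, hj, rfl | rfl⟩ | rfl)
  · have hlej := hle j hj
    have hnj := hnonneg j hj
    have hkj := hk j
    simp only [map_sub, initialSum_stdVec, Fin.val_zero]
    grind
  · have hlej := hle j hj
    have hnj := hnonneg j hj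
    have hkj := hk j
    simp only [map_add, initialSum_stdVec, Fin.val_zero]
    grind
  · simp only [initialSum_stdVec, Fin.val_zero]
    grind

/-- the number of distinct sets `S₊(λ)`, as `λ` ranges over the admissible
linear functionals on `ℝ^l` (type `B_l` data) with `S₋(λ) = ∅`, equals `l + 1`. -/
theorem count_Splus_Sminus_empty_B (l : ℕ) [NeZero l] :
    Set.ncard {S : Set (Fin l → ℝ) |
        ∃ lam : (Fin l → ℝ) →ₗ[ℝ] ℝ, AdmissibleB l lam ∧
          SminusB l lam = ∅ ∧ S = SplusB l lam} = l + 1 := by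
  have hset : {S : Set (Fin l → ℝ) |
        ∃ lam : (Fin l → ℝ) →ₗ[ℝ] ℝ, AdmissibleB l lam ∧
          SminusB l lam = ∅ ∧ S = SplusB l lam} =
      (fun k : ℕ => SplusB l (initialSum l k)) '' Set.Iic l := by
    ext S
    constructor
    · rintro ⟨lam, hadm, hneg, rfl⟩
      obtain ⟨k, hkl, hk⟩ := exists_SplusB_eq_initialSum hadm hneg
      exact ⟨k, hkl, hk.symm⟩
    · rintro ⟨k, -, rfl⟩
      exact ⟨_, admissibleB_initialSum l k, SminusB_initialSum l k, rfl⟩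
  have hinj : Set.InjOn (fun k : ℕ => SplusB l (initialSum l k)) (Set.Iic l) := by
    intro k hk m hm h
    by_contra hne
    rcases lt_or_gt_of_ne hne with hlt | hlt
    · exact SplusB_initialSum_ne hlt hm h
    · exact SplusB_initialSum_ne hlt hk h.symm
  rw [hset, hinj.ncard_image, ← Finset.coe_Iic, Set.ncard_coe_finset, Nat.card_Iic]
end
end

section
/- The number of distinct sets S₊(λ), as λ ranges over the admissible linear functionals on ℝ^l (type B_l data) with S₋(λ) = {e_1 − e_j : 2 ≤ j ≤ l} ∪ {e_1}, equals l. -/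
noncomputable section

theorem stdVec_self {l : ℕ} (i : Fin l) : stdVec l i i = 1 := by simp [stdVec]

theorem stdVec_of_ne {l : ℕ} {i j : Fin l} (h : j ≠ i) : stdVec l i j = 0 := by
  simp [stdVec, h]

theorem stdVec_nonneg {l : ℕ} (i j : Fin l) : 0 ≤ stdVec l i j := by
  by_cases h : j = i
  · simp [h, stdVec_self]
  · rw [stdVec_of_ne h]

/-- The roots `e₀ + eⱼ` with `0 < j ≤ p`. -/
def sumRootsUpTo (l : ℕ) [NeZero l] (p : Fin l) : Set (Fin l → ℝ) :=
  {v | ∃ j : Fin l, 0 < (j : ℕ) ∧ j ≤ p ∧ v = stdVec l 0 + stdVec l j}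

theorem ne_zero_of_val_pos {l : ℕ} [NeZero l] {j : Fin l} (hj : 0 < (j : ℕ)) : j ≠ 0 := by
  rintro rfl
  simp at hj

theorem sumRootsUpTo_subset_iff (l : ℕ) [NeZero l] {p q : Fin l} :
    sumRootsUpTo l p ⊆ sumRootsUpTo l q ↔ p ≤ q := by
  constructor
  · intro h
    rcases Nat.eq_zero_or_pos (p : ℕ) with hp | hp
    · exact Fin.le_def.2 (by omega)
    · obtain ⟨j, -, hjq, hj⟩ := h ⟨p, hp, le_rfl, rfl⟩
      have hpj : p = j := by
        by_contra hne
        have := congrFun (add_left_cancel hj) p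
        rw [stdVec_self, stdVec_of_ne hne] at this
        exact one_ne_zero this
      exact hpj ▸ hjq
  · rintro h _ ⟨j, hj, hjp, rfl⟩
    exact ⟨j, hj, hjp.trans h, rfl⟩

theorem sumRootsUpTo_injective (l : ℕ) [NeZero l] :
    Function.Injective (sumRootsUpTo l) := fun _ _ h =>
  le_antisymm ((sumRootsUpTo_subset_iff l).1 h.le) ((sumRootsUpTo_subset_iff l).1 h.ge)

/-- The roots `e₀ - eⱼ` with `0 < j`, together with `e₀`. -/
def lowerRoots (l : ℕ) [NeZero l] : Set (Fin l → ℝ) :=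
  {v | ∃ j : Fin l, 1 ≤ (j : ℕ) ∧ v = stdVec l 0 - stdVec l j} ∪ {stdVec l 0}

theorem add_notMem_lowerRoots {l : ℕ} [NeZero l] {j : Fin l} (hj : 0 < (j : ℕ)) :
    stdVec l 0 + stdVec l j ∉ lowerRoots l := by
  have h0 : stdVec l 0 j = 0 := stdVec_of_ne (ne_zero_of_val_pos hj)
  rintro (⟨k, -, h⟩ | h)
  · have h1 := congrFun h j
    have h2 := stdVec_nonneg k j
    simp only [Pi.add_apply, Pi.sub_apply, h0, stdVec_self] at h1
    linarith
  · have h1 := congrFun h j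
    simp only [Pi.add_apply, h0, stdVec_self] at h1
    linarith

theorem AdmissibleB.nonneg {l : ℕ} {lam : (Fin l → ℝ) →ₗ[ℝ] ℝ} (h : AdmissibleB l lam)
    {i : Fin l} (hi : 0 < (i : ℕ)) : 0 ≤ lam (stdVec l i) :=
  h _ (Or.inr ⟨i, hi, rfl⟩)

theorem AdmissibleB.antitone {l : ℕ} {lam : (Fin l → ℝ) →ₗ[ℝ] ℝ} (h : AdmissibleB l lam)
    {i j : Fin l} (hi : 0 < (i : ℕ)) (hij : i ≤ j) :
    lam (stdVec l j) ≤ lam (stdVec l i) := by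
  rcases hij.eq_or_lt with rfl | hlt
  · exact le_rfl
  · have := h _ (Or.inl ⟨i, j, hi, hlt, Or.inl rfl⟩)
    rw [map_sub] at this
    linarith

theorem sminusB_eq_lowerRoots_iff {l : ℕ} [NeZero l] {lam : (Fin l → ℝ) →ₗ[ℝ] ℝ}
    (h : AdmissibleB l lam) :
    SminusB l lam = lowerRoots l ↔ lam (stdVec l 0) < 0 ∧
      ∀ j : Fin l, 0 < (j : ℕ) → 0 ≤ lam (stdVec l 0) + lam (stdVec l j) := by
  constructor
  · intro hS
    refine ⟨(hS.ge (Or.inr rfl)).2, fun j hj => ?_⟩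
    by_contra! hlt
    rw [← map_add] at hlt
    exact add_notMem_lowerRoots hj (hS.le ⟨Or.inl ⟨j, hj, Or.inr rfl⟩, hlt⟩)
  · rintro ⟨h0, hadd⟩
    ext v
    constructor
    · rintro ⟨⟨j, hj, rfl | rfl⟩ | rfl, hv⟩
      · exact Or.inl ⟨j, hj, rfl⟩
      · rw [map_add] at hv
        exact absurd hv (hadd j hj).not_gt
      · exact Or.inr rfl
    · rintro (⟨j, hj, rfl⟩ | rfl)
      · refine ⟨Or.inl ⟨j, hj, Or.inl rfl⟩, ?_⟩
        have := h.nonneg hj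
        rw [map_sub]
        linarith
      · exact ⟨Or.inr rfl, h0⟩

theorem splusB_eq_sumRootsUpTo {l : ℕ} [NeZero l] {lam : (Fin l → ℝ) →ₗ[ℝ] ℝ}
    (h : AdmissibleB l lam) (h0 : lam (stdVec l 0) < 0) {p : Fin l}
    (hp : ∀ j : Fin l, 0 < (j : ℕ) →
      (0 < lam (stdVec l 0) + lam (stdVec l j) ↔ j ≤ p)) :
    SplusB l lam = sumRootsUpTo l p := by
  ext v
  constructor
  · rintro ⟨⟨j, hj, rfl | rfl⟩ | rfl, hv⟩
    · have := h.nonneg hj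
      rw [map_sub] at hv
      linarith
    · rw [map_add] at hv
      exact ⟨j, hj, (hp j hj).1 hv, rfl⟩
    · exact absurd hv h0.not_gt
  · rintro ⟨j, hj, hjp, rfl⟩
    refine ⟨Or.inl ⟨j, hj, Or.inr rfl⟩, ?_⟩
    rw [map_add]
    exact (hp j hj).2 hjp

theorem AdmissibleB.exists_threshold {l : ℕ} [NeZero l] {lam : (Fin l → ℝ) →ₗ[ℝ] ℝ}
    (h : AdmissibleB l lam) :
    ∃ p : Fin l, ∀ j : Fin l, 0 < (j : ℕ) →
      (0 < lam (stdVec l 0) + lam (stdVec l j) ↔ j ≤ p) := by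
  obtain ⟨p, hp, hmax⟩ := Set.exists_max_image
    {j : Fin l | j = 0 ∨ 0 < lam (stdVec l 0) + lam (stdVec l j)} id
    (Set.toFinite _) ⟨0, Or.inl rfl⟩
  refine ⟨p, fun j hj => ⟨fun hlt => hmax j (Or.inr hlt), fun hjp => ?_⟩⟩
  rcases hp with rfl | hp
  · rw [Fin.le_def, Fin.val_zero] at hjp
    omega
  · have := h.antitone hj hjp
    linarith

/-- The functional with value `-1` at `e₀`, `2` at `eⱼ` for `0 < j ≤ p` and `1` at later `eⱼ`. -/
def stepFunctional (l : ℕ) [NeZero l] (p : Fin l) : (Fin l → ℝ) →ₗ[ℝ] ℝ :=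
  (Pi.basisFun ℝ (Fin l)).constr ℝ fun j => if j = 0 then -1 else if j ≤ p then 2 else 1

theorem stepFunctional_stdVec (l : ℕ) [NeZero l] (p j : Fin l) :
    stepFunctional l p (stdVec l j) = if j = 0 then -1 else if j ≤ p then 2 else 1 := by
  rw [stdVec, ← Pi.basisFun_apply, stepFunctional, Module.Basis.constr_basis]

theorem stepFunctional_zero (l : ℕ) [NeZero l] (p : Fin l) :
    stepFunctional l p (stdVec l 0) = -1 := by
  rw [stepFunctional_stdVec, if_pos rfl]

theorem stepFunctional_of_pos {l : ℕ} [NeZero l] (p : Fin l) {j : Fin l}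
    (hj : 0 < (j : ℕ)) :
    stepFunctional l p (stdVec l j) = if j ≤ p then 2 else 1 := by
  rw [stepFunctional_stdVec, if_neg (ne_zero_of_val_pos hj)]

theorem admissibleB_stepFunctional (l : ℕ) [NeZero l] (p : Fin l) :
    AdmissibleB l (stepFunctional l p) := by
  rintro _ (⟨i, j, hi, hij, rfl | rfl⟩ | ⟨i, hi, rfl⟩)
  · rw [map_sub, stepFunctional_of_pos p hi,
      stepFunctional_of_pos p (hi.trans (Fin.lt_def.1 hij))]
    split_ifs with h1 h2
    any_goals norm_num
    exact absurd (hij.le.trans ‹j ≤ p›) h1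
  · rw [map_add, stepFunctional_of_pos p hi,
      stepFunctional_of_pos p (hi.trans (Fin.lt_def.1 hij))]
    split_ifs <;> norm_num
  · rw [stepFunctional_of_pos p hi]
    split_ifs <;> norm_num

/-- the number of distinct sets `S₊(λ)`, as `λ` ranges over the admissible
linear functionals on `ℝ^l` (type `B_l` data) with
`S₋(λ) = {e₁ − eⱼ : 2 ≤ j ≤ l} ∪ {e₁}` (1-indexed), equals `l`. -/
theorem count_Splus_Sminus_halfB (l : ℕ) [NeZero l] :
    Set.ncard {S : Set (Fin l → ℝ) |
        ∃ lam : (Fin l → ℝ) →ₗ[ℝ] ℝ, AdmissibleB l lam ∧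
          SminusB l lam =
            ({v | ∃ j : Fin l, 1 ≤ (j : ℕ) ∧ v = stdVec l 0 - stdVec l j} ∪ {stdVec l 0}) ∧
          S = SplusB l lam} = l := by
  have hrange : {S : Set (Fin l → ℝ) | ∃ lam : (Fin l → ℝ) →ₗ[ℝ] ℝ, AdmissibleB l lam ∧
      SminusB l lam = lowerRoots l ∧ S = SplusB l lam} = Set.range (sumRootsUpTo l) := by
    ext S
    constructor
    · rintro ⟨lam, hadm, hS, rfl⟩
      obtain ⟨p, hp⟩ := hadm.exists_threshold
      exact ⟨p, (splusB_eq_sumRootsUpTo hadm ((sminusB_eq_lowerRoots_iff hadm).1 hS).1 hp).symm⟩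
    · rintro ⟨p, rfl⟩
      have hadm := admissibleB_stepFunctional l p
      have h0 : stepFunctional l p (stdVec l 0) < 0 := by
        rw [stepFunctional_zero]
        norm_num
      refine ⟨stepFunctional l p, hadm,
        (sminusB_eq_lowerRoots_iff hadm).2 ⟨h0, fun j hj => ?_⟩,
        (splusB_eq_sumRootsUpTo hadm h0 fun j hj => ?_).symm⟩
      · rw [stepFunctional_zero, stepFunctional_of_pos p hj]
        split_ifs <;> norm_num
      · rw [stepFunctional_zero, stepFunctional_of_pos p hj]
        split_ifs with h <;> norm_num [h]
  change Set.ncard {S : Set (Fin l → ℝ) | ∃ lam : (Fin l → ℝ) →ₗ[ℝ] ℝ, AdmissibleB l lam ∧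
    SminusB l lam = lowerRoots l ∧ S = SplusB l lam} = l
  rw [hrange, ← Nat.card_coe_set_eq, Nat.card_range_of_injective (sumRootsUpTo_injective l),
    Nat.card_fin]
end
end
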